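/- arXiv:0911.3970 — 2 statements merged into one kernel-verified Lean document; each statement's English description precedes it below -/
import Mathlib

section
/- Assume L²(Ω₁,ν₁) and L²(Ω₂,ν₂) are infinite-dimensional. Then the following cardinality inequalities hold: |σ_d(K₁)| + 1 ≤ |σ_e(T)|, |σ_d(K₂)| + 1 ≤ |σ_e(T)|, and |σ_e(T)| ≤ |σ_d(K₁)| + |σ_d(K₂)| + 1, where |·| denotes the cardinality of a set. -/
open MeasureTheory Filter Topology Metric

noncomputable section

variable {𝓗 : Type*} [NormedAddCommGroup 𝓗] [InnerProductSpace ℂ 𝓗]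

/-- `z` is an isolated point of the set `S`. -/
def IsIsolatedIn (S : Set ℂ) (z : ℂ) : Prop :=
  z ∈ S ∧ ∃ ε > 0, S ∩ Metric.ball z ε = {z}

/-- Discrete spectrum: the set of isolated points of the spectrum that are eigenvalues of
finite multiplicity. -/
def discreteSpectrum (A : 𝓗 →L[ℂ] 𝓗) : Set ℂ :=
  {z | IsIsolatedIn (spectrum ℂ A) z ∧
    Module.End.HasEigenvalue (A : 𝓗 →ₗ[ℂ] 𝓗) z ∧
    FiniteDimensional ℂ (Module.End.eigenspace (A : 𝓗 →ₗ[ℂ] 𝓗) z)}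

/-- Essential spectrum: spectrum minus discrete spectrum. -/
def essSpectrum (A : 𝓗 →L[ℂ] 𝓗) : Set ℂ :=
  spectrum ℂ A \ discreteSpectrum A

/-- Bottom of the essential spectrum (as a real number). -/
def Emin (A : 𝓗 →L[ℂ] 𝓗) : ℝ :=
  sInf {x : ℝ | (x : ℂ) ∈ essSpectrum A}

/-- The span of all eigenspaces with (real) eigenvalue strictly below `E`; its dimension is
the number of eigenvalues below `E` counted with multiplicity. -/
def eigBelow (A : 𝓗 →L[ℂ] 𝓗) (E : ℝ) : Submodule ℂ 𝓗 :=
  ⨆ t : {t : ℝ // t < E}, Module.End.eigenspace (A : 𝓗 →ₗ[ℂ] 𝓗) ((t : ℝ) : ℂ)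

section Diagonal

variable {H : Type*} [NormedAddCommGroup H] [InnerProductSpace ℂ H]

lemma diag_coord {ι : Type*} (b : HilbertBasis ι ℂ H) (A : H →L[ℂ] H)
    (a : ι → ℂ) (hA : ∀ i, A (b i) = a i • b i) (x : H) (i : ι) :
    inner ℂ (b i) (A x) = a i * inner ℂ (b i) x := by
  have h : ((innerSL ℂ (b i)).comp A : H →L[ℂ] ℂ) = a i • innerSL ℂ (b i) := by
    apply ContinuousLinearMap.ext_on (s := Set.range b)
    · exact (Submodule.dense_iff_topologicalClosure_eq_top.mpr b.dense_span)
    · rintro _ ⟨j, rfl⟩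
      simp only [ContinuousLinearMap.comp_apply, hA, innerSL_apply_apply, inner_smul_right,
        _root_.smul_apply, smul_eq_mul]
      by_cases hij : i = j
      · rw [hij]
      · rw [b.orthonormal.2 hij]; simp
  have := congrArg (fun f => f x) h
  simpa using this

lemma diag_mem_spectrum [CompleteSpace H] {ι : Type*} (b : HilbertBasis ι ℂ H) (A : H →L[ℂ] H)
    (a : ι → ℂ) (hA : ∀ i, A (b i) = a i • b i) (z : ℂ) :
    z ∈ spectrum ℂ A ↔ ∀ ε > 0, ∃ i, ‖a i - z‖ < ε := by
  rw [← not_iff_not, spectrum.notMem_iff]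
  push Not
  set B : H →L[ℂ] H := algebraMap ℂ (H →L[ℂ] H) z - A with hB
  have hBb : ∀ i, B (b i) = (z - a i) • b i := by
    intro i
    simp [hB, hA, sub_smul, Algebra.algebraMap_eq_smul_one]
  constructor
  · rintro ⟨u, hu⟩
    refine ⟨1 / (‖(↑u⁻¹ : H →L[ℂ] H)‖ + 1), by positivity, fun i => ?_⟩
    have h1 : (↑u⁻¹ : H →L[ℂ] H) (B (b i)) = b i := by
      rw [← hu, ← mul_apply_eq_comp, Units.inv_mul]; rfl
    have h2 : ‖b i‖ = 1 := b.orthonormal.1 i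
    have h3 : ‖b i‖ ≤ ‖(↑u⁻¹ : H →L[ℂ] H)‖ * ‖B (b i)‖ := by
      conv_lhs => rw [← h1]
      exact ContinuousLinearMap.le_opNorm _ _
    rw [hBb, norm_smul, h2, mul_one, norm_sub_rev] at h3
    rw [div_le_iff₀ (by positivity)]
    nlinarith [norm_nonneg (a i - z)]
  · rintro ⟨ε, hε, h⟩
    rw [ContinuousLinearMap.isUnit_iff_bijective,
      ContinuousLinearMap.bijective_iff_dense_range_and_antilipschitz]
    constructor
    · rw [eq_top_iff, ← b.dense_span]
      apply Submodule.topologicalClosure_mono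
      rw [Submodule.span_le]
      rintro _ ⟨i, rfl⟩
      have hne : z - a i ≠ 0 := by
        intro h0
        have := h i
        rw [norm_sub_rev, h0, norm_zero] at this
        linarith
      exact ⟨(z - a i)⁻¹ • b i, by simp [hBb, smul_smul, hne]⟩
    · refine ⟨⟨ε⁻¹, by positivity⟩, ?_⟩
      apply ContinuousLinearMap.antilipschitz_of_bound
      intro x
      have hs : ∀ y : H, HasSum (fun i => ‖inner ℂ (b i) y‖ ^ 2) (‖y‖ ^ 2) := by
        intro y
        have := b.hasSum_inner_mul_inner y y
        have h2 := Complex.hasSum_re this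
        convert h2 using 1
        · ext i
          rw [← inner_conj_symm y (b i), mul_comm, Complex.mul_conj, Complex.ofReal_re,
            Complex.normSq_eq_norm_sq]
        · exact (inner_self_eq_norm_sq (𝕜 := ℂ) y).symm
      have h1 : ε ^ 2 * ‖x‖ ^ 2 ≤ ‖B x‖ ^ 2 := by
        refine hasSum_le ?_ ((hs x).mul_left (ε ^ 2)) (hs (B x))
        intro i
        rw [diag_coord b B _ hBb, norm_mul, mul_pow]
        gcongr
        rw [norm_sub_rev]; exact h i
      have h2 : ε * ‖x‖ ≤ ‖B x‖ := by
        rw [← mul_pow] at h1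
        exact le_of_sq_le_sq h1 (norm_nonneg _)
      change ‖x‖ ≤ ε⁻¹ * ‖B x‖
      rw [inv_mul_eq_div, le_div_iff₀ hε]; linarith

lemma diag_eigenspace {ι : Type*} (b : HilbertBasis ι ℂ H) (A : H →L[ℂ] H)
    (a : ι → ℂ) (hA : ∀ i, A (b i) = a i • b i) (z : ℂ) :
    FiniteDimensional ℂ (Module.End.eigenspace (A : H →ₗ[ℂ] H) z) ↔ {i | a i = z}.Finite := by
  constructor
  · intro hf
    let v : {i | a i = z} → Module.End.eigenspace (A : H →ₗ[ℂ] H) z := fun i =>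
      ⟨b i, by rw [Module.End.mem_eigenspace_iff]; simp [hA, i.2.symm]⟩
    have hv : LinearIndependent ℂ v := by
      apply LinearIndependent.of_comp (Submodule.subtype _)
      exact b.orthonormal.linearIndependent.comp _ Subtype.val_injective
    have := hv.finite
    exact Set.toFinite _
  · intro hf
    have hle : Module.End.eigenspace (A : H →ₗ[ℂ] H) z ≤ Submodule.span ℂ (b '' {i | a i = z}) := by
      intro x hx
      rw [Module.End.mem_eigenspace_iff] at hx
      have hx0 : ∀ i, a i ≠ z → inner ℂ (b i) x = 0 := by
        intro i hi
        have h1 := diag_coord b A a hA x i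
        change A x = z • x at hx
        rw [hx, inner_smul_right] at h1
        have : (a i - z) * inner ℂ (b i) x = 0 := by rw [sub_mul, h1, sub_self]
        exact (mul_eq_zero.mp this).resolve_left (sub_ne_zero.mpr hi)
      have hs := b.hasSum_repr x
      have hs2 : HasSum (fun i => b.repr x i • b i) (∑ i ∈ hf.toFinset, b.repr x i • b i) := by
        apply hasSum_sum_of_ne_finset_zero
        intro i hi
        rw [b.repr_apply_apply, hx0 i (by simpa using hi), zero_smul]
      rw [hs.unique hs2]
      refine Submodule.sum_mem _ fun i hi => Submodule.smul_mem _ _ (Submodule.subset_span ⟨i, ?_, rfl⟩)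
      simpa using hi
    have : FiniteDimensional ℂ (Submodule.span ℂ (b '' {i | a i = z})) :=
      FiniteDimensional.span_of_finite ℂ (hf.image b)
    exact Submodule.finiteDimensional_of_le hle

lemma diag_hasEigenvalue {ι : Type*} (b : HilbertBasis ι ℂ H) (A : H →L[ℂ] H)
    (a : ι → ℂ) (hA : ∀ i, A (b i) = a i • b i) (i : ι) :
    Module.End.HasEigenvalue (A : H →ₗ[ℂ] H) (a i) := by
  apply Module.End.hasEigenvalue_of_hasEigenvector (x := b i)
  refine ⟨Module.End.mem_eigenspace_iff.mpr (hA i), b.orthonormal.ne_zero i⟩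

lemma diag_mem_ess [CompleteSpace H] {ι : Type*} (b : HilbertBasis ι ℂ H) (A : H →L[ℂ] H)
    (a : ι → ℂ) (hA : ∀ i, A (b i) = a i • b i) (z : ℂ) :
    z ∈ essSpectrum A ↔ ∀ ε > 0, {i | ‖a i - z‖ < ε}.Infinite := by
  constructor
  · rintro ⟨hz, hd⟩ ε hε hfin
    apply hd
    -- shrink
    obtain ⟨δ, hδ, hδa⟩ : ∃ δ > 0, ∀ i, ‖a i - z‖ < δ → a i = z := by
      have hfin2 : ((fun i => a i) '' {i | ‖a i - z‖ < ε} \ {z}).Finite := (hfin.image _).sdiff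
      have := hfin2.isClosed.isOpen_compl.mem_nhds (x := z) (by simp)
      obtain ⟨r, hr, hrs⟩ := Metric.mem_nhds_iff.mp this
      refine ⟨min r ε, lt_min hr hε, fun i hi => ?_⟩
      by_contra hne
      have h1 : a i ∈ Metric.ball z r := by
        rw [Metric.mem_ball, dist_eq_norm]; exact hi.trans_le (min_le_left _ _)
      exact hrs h1 ⟨⟨i, hi.trans_le (min_le_right _ _), rfl⟩, hne⟩
    have hz' := (diag_mem_spectrum b A a hA z).mp hz
    obtain ⟨i, hi⟩ := hz' δ hδ
    refine ⟨⟨hz, δ, hδ, ?_⟩, ?_, ?_⟩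
    · apply Set.eq_singleton_iff_unique_mem.mpr
      refine ⟨⟨hz, Metric.mem_ball_self hδ⟩, ?_⟩
      rintro w ⟨hw, hwb⟩
      by_contra hne
      rw [Metric.mem_ball, dist_eq_norm] at hwb
      have hpos : 0 < ‖w - z‖ := norm_pos_iff.mpr (sub_ne_zero.mpr hne)
      obtain ⟨j, hj⟩ := (diag_mem_spectrum b A a hA w).mp hw (min (δ - ‖w - z‖) ‖w - z‖)
        (lt_min (by linarith) hpos)
      have hj1 := hj.trans_le (min_le_left _ _)
      have hj2 := hj.trans_le (min_le_right _ _)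
      have : a j = z := by
        apply hδa
        have : a j - z = (a j - w) + (w - z) := by ring
        rw [this]
        linarith [norm_add_le (a j - w) (w - z)]
      rw [this, norm_sub_rev] at hj2
      exact lt_irrefl _ hj2
    · rw [← hδa i hi]; exact diag_hasEigenvalue b A a hA i
    · rw [diag_eigenspace b A a hA]
      refine hfin.subset ?_
      intro j hj
      simp only [Set.mem_ofPred_eq] at hj ⊢
      simpa [hj] using hε
  · intro h
    refine ⟨(diag_mem_spectrum b A a hA z).mpr fun ε hε => (h ε hε).nonempty, ?_⟩
    rintro ⟨⟨-, ε, hε, hiso⟩, -, hfd⟩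
    rw [diag_eigenspace b A a hA] at hfd
    refine h ε hε (hfd.subset ?_)
    intro i hi
    have : a i ∈ spectrum ℂ A ∩ Metric.ball z ε :=
      ⟨(diag_mem_spectrum b A a hA _).mpr fun ε hε => ⟨i, by simpa using hε⟩,
        by rw [Metric.mem_ball, dist_eq_norm]; exact hi⟩
    rw [hiso] at this
    exact this

lemma compact_diag {H : Type} [NormedAddCommGroup H] [InnerProductSpace ℂ H] [CompleteSpace H] (K : H →L[ℂ] H) (hc : IsCompactOperator K)
    (hs : IsSelfAdjoint K) (hinf : ¬ FiniteDimensional ℂ H) :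
    ∃ (ι : Type) (b : HilbertBasis ι ℂ H) (a : ι → ℂ), Infinite ι ∧
      (∀ i, K (b i) = a i • b i) ∧ ∀ ε > 0, {i | ε ≤ ‖a i‖}.Finite := by
  have hsym : (K : H →ₗ[ℂ] H).IsSymmetric := hs.isSymmetric
  have hbot := ContinuousLinearMap.orthogonalComplement_iSup_eigenspaces_eq_bot hc hsym
  have hex : ∀ μ : ℂ, ∃ (w : Set (Module.End.eigenspace (K : H →ₗ[ℂ] H) μ))
      (b : HilbertBasis w ℂ (Module.End.eigenspace (K : H →ₗ[ℂ] H) μ)), ⇑b = ((↑) : w → _) := by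
    intro μ
    have hcl : IsClosed (Module.End.eigenspace (K : H →ₗ[ℂ] H) μ : Set H) := by
      have : (Module.End.eigenspace (K : H →ₗ[ℂ] H) μ : Set H) = {x | K x = μ • x} := by
        ext x; simp
      rw [this]
      exact isClosed_eq K.continuous (continuous_const_smul μ)
    have : CompleteSpace (Module.End.eigenspace (K : H →ₗ[ℂ] H) μ) :=
      hcl.completeSpace_coe
    exact exists_hilbertBasis ℂ _
  choose w b hb using hex
  let v : (Σ μ : ℂ, w μ) → H := fun i => ((b i.1 i.2 : Module.End.eigenspace (K : H →ₗ[ℂ] H) i.1) : H)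
  have hv : Orthonormal ℂ v :=
    hsym.orthogonalFamily_eigenspaces.orthonormal_sigma_orthonormal (fun μ => (b μ).orthonormal)
  have hspan : (Submodule.span ℂ (Set.range v))ᗮ = ⊥ := by
    rw [eq_bot_iff, ← hbot]
    intro x hx
    rw [Submodule.mem_orthogonal'] at hx
    rw [← Submodule.iInf_orthogonal, Submodule.mem_iInf]
    intro μ
    rw [Submodule.mem_orthogonal']
    intro y hy
    have hs := (b μ).hasSum_repr ⟨y, hy⟩
    have h2 := hs.mapL ((innerSL ℂ x).comp (Submodule.subtypeL _))
    have h3 : (fun i => ((innerSL ℂ x).comp (Submodule.subtypeL _))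
        ((b μ).repr ⟨y, hy⟩ i • b μ i)) = fun _ => 0 := by
      ext i
      have : inner ℂ x (v ⟨μ, i⟩) = 0 := hx _ (Submodule.subset_span ⟨_, rfl⟩)
      simp only [map_smul, ContinuousLinearMap.comp_apply, Submodule.subtypeL_apply,
        innerSL_apply_apply]
      rw [show inner ℂ x ((b μ i : Module.End.eigenspace (K : H →ₗ[ℂ] H) μ) : H) = 0 from this,
        smul_zero]
    rw [h3] at h2
    exact h2.unique hasSum_zero
  let B := HilbertBasis.mkOfOrthogonalEqBot hv hspan
  have hB : ⇑B = v := HilbertBasis.coe_mkOfOrthogonalEqBot hv hspan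
  have hBK : ∀ i : (Σ μ : ℂ, w μ), K (B i) = i.1 • B i := by
    intro i
    rw [hB]
    exact Module.End.mem_eigenspace_iff.mp (b i.1 i.2).2
  refine ⟨(Σ μ : ℂ, w μ), B, fun i => i.1, ?_, hBK, ?_⟩
  · by_contra hfin
    rw [not_infinite_iff_finite] at hfin
    have := Fintype.ofFinite (Σ μ : ℂ, w μ)
    exact hinf (B.toOrthonormalBasis.toBasis.finiteDimensional_of_finite)
  · intro ε hε
    by_contra hinfS
    have hinfS : {i : Σ μ : ℂ, w μ | ε ≤ ‖i.1‖}.Infinite := hinfS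
    let f := hinfS.natEmbedding
    obtain ⟨C, hC, hCK⟩ := IsCompactOperator.image_closedBall_subset_compact (f := (K : H →ₗ[ℂ] H)) hc 1
    have hmem : ∀ n, K (B (f n)) ∈ C := fun n => hCK ⟨_, by simp [B.orthonormal.1], rfl⟩
    obtain ⟨x, -, φ, hφ, hlim⟩ := hC.tendsto_subseq hmem
    have hcau := hlim.cauchySeq
    rw [Metric.cauchySeq_iff] at hcau
    obtain ⟨N, hN⟩ := hcau ε hε
    have h1 := hN N le_rfl (N + 1) (Nat.le_succ N)
    have hne : (f (φ N) : Σ μ : ℂ, w μ) ≠ f (φ (N + 1)) := by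
      intro h
      have := hφ.injective (f.injective (Subtype.ext h))
      omega
    have h2 : inner ℂ (B (f (φ N))) (K (B (f (φ N))) - K (B (f (φ (N + 1))))) =
        (f (φ N) : Σ μ : ℂ, w μ).1 := by
      rw [hBK, hBK, inner_sub_right, inner_smul_right, inner_smul_right, B.orthonormal.2 hne,
        inner_self_eq_norm_sq_to_K, B.orthonormal.1]
      simp
    have h3 := norm_inner_le_norm (𝕜 := ℂ) (B (f (φ N)))
      (K (B (f (φ N))) - K (B (f (φ (N + 1)))))
    rw [h2, B.orthonormal.1, one_mul, ← dist_eq_norm] at h3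
    have h4 : ε ≤ ‖(f (φ N) : Σ μ : ℂ, w μ).1‖ := (f (φ N)).2
    exact absurd h1 (not_lt.mpr (h4.trans h3))

end Diagonal

section Tensor

variable {X Y : Type*} [MeasurableSpace X] [MeasurableSpace Y]
  {μ : Measure X} {ν : Measure Y} [IsFiniteMeasure μ] [IsFiniteMeasure ν]

lemma memLp_tens (φ : Lp ℂ 2 μ) (ψ : Lp ℂ 2 ν) :
    MemLp (fun p : X × Y => φ p.1 * ψ p.2) 2 (μ.prod ν) := by
  have hm : AEStronglyMeasurable (fun p : X × Y => φ p.1 * ψ p.2) (μ.prod ν) :=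
    (Lp.aestronglyMeasurable φ).comp_fst.mul (Lp.aestronglyMeasurable ψ).comp_snd
  rw [memLp_two_iff_integrable_sq_norm hm]
  have h1 := (memLp_two_iff_integrable_sq_norm (Lp.aestronglyMeasurable φ)).mp (Lp.memLp φ)
  have h2 := (memLp_two_iff_integrable_sq_norm (Lp.aestronglyMeasurable ψ)).mp (Lp.memLp ψ)
  simpa [mul_pow] using h1.mul_prod h2

/-- The elementary tensor `φ ⊗ ψ` in `L²` of the product. -/
def tens (φ : Lp ℂ 2 μ) (ψ : Lp ℂ 2 ν) : Lp ℂ 2 (μ.prod ν) := (memLp_tens φ ψ).toLp _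

lemma coe_tens (φ : Lp ℂ 2 μ) (ψ : Lp ℂ 2 ν) :
    tens φ ψ =ᵐ[μ.prod ν] fun p : X × Y => φ p.1 * ψ p.2 := MemLp.coeFn_toLp _

lemma inner_tens (φ φ' : Lp ℂ 2 μ) (ψ ψ' : Lp ℂ 2 ν) :
    inner ℂ (tens φ ψ) (tens φ' ψ') = inner ℂ φ φ' * inner ℂ ψ ψ' := by
  rw [L2.inner_def, L2.inner_def, L2.inner_def, ← integral_prod_mul]
  apply integral_congr_ae
  filter_upwards [coe_tens φ ψ, coe_tens φ' ψ'] with p h1 h2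
  rw [h1, h2]
  simp only [RCLike.inner_apply, map_mul]
  ring

lemma norm_tens (φ : Lp ℂ 2 μ) (ψ : Lp ℂ 2 ν) : ‖tens φ ψ‖ = ‖φ‖ * ‖ψ‖ := by
  have h := inner_tens φ φ ψ ψ
  simp only [inner_self_eq_norm_sq_to_K] at h
  have h2 : ‖tens φ ψ‖ ^ 2 = (‖φ‖ * ‖ψ‖) ^ 2 := by
    rw [mul_pow]; exact_mod_cast h
  exact (sq_eq_sq₀ (norm_nonneg _) (by positivity)).mp h2

lemma ae_fst {p : X → Prop} (h : ∀ᵐ x ∂μ, p x) : ∀ᵐ z ∂(μ.prod ν), p z.1 :=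
  Measure.quasiMeasurePreserving_fst.ae h

lemma ae_snd {p : Y → Prop} (h : ∀ᵐ x ∂ν, p x) : ∀ᵐ z ∂(μ.prod ν), p z.2 :=
  Measure.quasiMeasurePreserving_snd.ae h

lemma tens_add_left (φ φ' : Lp ℂ 2 μ) (ψ : Lp ℂ 2 ν) :
    tens (φ + φ') ψ = tens φ ψ + tens φ' ψ := by
  apply Lp.ext
  filter_upwards [coe_tens (φ + φ') ψ, coe_tens φ ψ, coe_tens φ' ψ,
    Lp.coeFn_add (tens φ ψ) (tens φ' ψ), ae_fst (ν := ν) (Lp.coeFn_add φ φ')] with p h1 h2 h3 h4 h5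
  simp only [h1, h2, h3, h4, h5, Pi.add_apply]
  ring

lemma tens_add_right (φ : Lp ℂ 2 μ) (ψ ψ' : Lp ℂ 2 ν) :
    tens φ (ψ + ψ') = tens φ ψ + tens φ ψ' := by
  apply Lp.ext
  filter_upwards [coe_tens φ (ψ + ψ'), coe_tens φ ψ, coe_tens φ ψ',
    Lp.coeFn_add (tens φ ψ) (tens φ ψ'), ae_snd (μ := μ) (Lp.coeFn_add ψ ψ')] with p h1 h2 h3 h4 h5
  simp only [h1, h2, h3, h4, h5, Pi.add_apply]
  ring

lemma tens_smul_left (c : ℂ) (φ : Lp ℂ 2 μ) (ψ : Lp ℂ 2 ν) :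
    tens (c • φ) ψ = c • tens φ ψ := by
  apply Lp.ext
  filter_upwards [coe_tens (c • φ) ψ, coe_tens φ ψ,
    Lp.coeFn_smul c (tens φ ψ), ae_fst (ν := ν) (Lp.coeFn_smul c φ)] with p h1 h2 h4 h5
  simp only [h1, h2, h4, h5, Pi.smul_apply, smul_eq_mul]
  ring

lemma tens_smul_right (c : ℂ) (φ : Lp ℂ 2 μ) (ψ : Lp ℂ 2 ν) :
    tens φ (c • ψ) = c • tens φ ψ := by
  apply Lp.ext
  filter_upwards [coe_tens φ (c • ψ), coe_tens φ ψ,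
    Lp.coeFn_smul c (tens φ ψ), ae_snd (μ := μ) (Lp.coeFn_smul c ψ)] with p h1 h2 h4 h5
  simp only [h1, h2, h4, h5, Pi.smul_apply, smul_eq_mul]
  ring

/-- `φ ↦ φ ⊗ ψ`. -/
def tensL (ψ : Lp ℂ 2 ν) : Lp ℂ 2 μ →L[ℂ] Lp ℂ 2 (μ.prod ν) :=
  LinearMap.mkContinuous
    { toFun := fun φ => tens φ ψ
      map_add' := fun φ φ' => tens_add_left φ φ' ψ
      map_smul' := fun c φ => tens_smul_left c φ ψ } ‖ψ‖
    (fun φ => by simp [norm_tens, mul_comm])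

/-- `ψ ↦ φ ⊗ ψ`. -/
def tensR (φ : Lp ℂ 2 μ) : Lp ℂ 2 ν →L[ℂ] Lp ℂ 2 (μ.prod ν) :=
  LinearMap.mkContinuous
    { toFun := fun ψ => tens φ ψ
      map_add' := fun ψ ψ' => tens_add_right φ ψ ψ'
      map_smul' := fun c ψ => tens_smul_right c φ ψ } ‖φ‖
    (fun ψ => by simp [norm_tens])

lemma eq_zero_of_tens (g : Lp ℂ 2 (μ.prod ν))
    (hg : ∀ (φ : Lp ℂ 2 μ) (ψ : Lp ℂ 2 ν), inner ℂ (tens φ ψ) g = 0) : g = 0 := by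
  have hint : Integrable g (μ.prod ν) := (Lp.memLp g).integrable (by norm_num)
  have hrect : ∀ (s : Set X) (t : Set Y), MeasurableSet s → MeasurableSet t →
      ∫ p in s ×ˢ t, g p ∂(μ.prod ν) = 0 := by
    intro s t hs ht
    have h1 : tens (indicatorConstLp 2 hs (measure_ne_top μ s) (1 : ℂ))
        (indicatorConstLp 2 ht (measure_ne_top ν t) (1 : ℂ)) =
        indicatorConstLp 2 (hs.prod ht) (measure_ne_top (μ.prod ν) _) (1 : ℂ) := by
      apply Lp.ext
      filter_upwards [coe_tens (indicatorConstLp 2 hs (measure_ne_top μ s) (1 : ℂ))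
        (indicatorConstLp 2 ht (measure_ne_top ν t) (1 : ℂ)),
        ae_fst (ν := ν) (indicatorConstLp_coeFn (p := 2) (hs := hs)
          (hμs := measure_ne_top μ s) (c := (1 : ℂ))),
        ae_snd (μ := μ) (indicatorConstLp_coeFn (p := 2) (hs := ht)
          (hμs := measure_ne_top ν t) (c := (1 : ℂ))),
        indicatorConstLp_coeFn (p := 2) (hs := hs.prod ht)
          (hμs := measure_ne_top (μ.prod ν) _) (c := (1 : ℂ))] with p h1 h2 h3 h4
      rw [h1, h2, h3, h4]
      by_cases hp1 : p.1 ∈ s <;> by_cases hp2 : p.2 ∈ t <;>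
        simp [Set.indicator, Set.mem_prod, hp1, hp2]
    have h2 := hg (indicatorConstLp 2 hs (measure_ne_top μ s) (1 : ℂ))
        (indicatorConstLp 2 ht (measure_ne_top ν t) (1 : ℂ))
    rwa [h1, L2.inner_indicatorConstLp_one] at h2
  have hall : ∀ u, MeasurableSet u → ∫ p in u, g p ∂(μ.prod ν) = 0 := by
    refine MeasurableSpace.induction_on_inter generateFrom_prod.symm isPiSystem_prod (by simp)
      ?_ ?_ ?_
    · rintro _ ⟨s, hs, t, ht, rfl⟩
      exact hrect s t hs ht
    · intro t ht h
      have h1 := integral_add_compl ht hint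
      have h2 := hrect Set.univ Set.univ MeasurableSet.univ MeasurableSet.univ
      rw [Set.univ_prod_univ, setIntegral_univ] at h2
      rw [h, h2, zero_add] at h1
      exact h1
    · intro f hd hm h
      rw [integral_iUnion hm hd hint.integrableOn]
      simp [h]
  have h0 := Lp.ae_eq_zero_of_forall_setIntegral_eq_zero g (by norm_num) (by norm_num)
    (fun s _ _ => hint.integrableOn) (fun s hs _ => hall s hs)
  exact (Lp.eq_zero_iff_ae_eq_zero).mpr h0

lemma exists_tens_basis {ι κ : Type*} (b : HilbertBasis ι ℂ (Lp ℂ 2 μ))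
    (c : HilbertBasis κ ℂ (Lp ℂ 2 ν)) :
    ∃ B : HilbertBasis (ι × κ) ℂ (Lp ℂ 2 (μ.prod ν)), ∀ i, B i = tens (b i.1) (c i.2) := by
  classical
  have ho : Orthonormal ℂ (fun i : ι × κ => tens (b i.1) (c i.2)) := by
    rw [orthonormal_iff_ite]
    rintro ⟨i, j⟩ ⟨i', j'⟩
    rw [inner_tens, orthonormal_iff_ite.mp b.orthonormal, orthonormal_iff_ite.mp c.orthonormal]
    by_cases h1 : i = i' <;> by_cases h2 : j = j' <;> simp [h1, h2]
  have hspan : (Submodule.span ℂ (Set.range (fun i : ι × κ => tens (b i.1) (c i.2))))ᗮ = ⊥ := by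
    rw [eq_bot_iff]
    intro g hg
    rw [Submodule.mem_orthogonal'] at hg
    have h0 : ∀ i j, inner ℂ g (tens (b i) (c j)) = 0 := fun i j =>
      hg _ (Submodule.subset_span ⟨(i, j), rfl⟩)
    have hden1 := Submodule.dense_iff_topologicalClosure_eq_top.mpr b.dense_span
    have hden2 := Submodule.dense_iff_topologicalClosure_eq_top.mpr c.dense_span
    have h1 : ∀ i ψ, inner ℂ g (tens (b i) ψ) = 0 := by
      intro i ψ
      have : (innerSL ℂ g).comp (tensR (ν := ν) (b i)) = 0 := by
        apply ContinuousLinearMap.ext_on hden2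
        rintro _ ⟨j, rfl⟩
        exact h0 i j
      exact congrArg (fun f => f ψ) this
    have h2 : ∀ φ ψ, inner ℂ g (tens φ ψ) = 0 := by
      intro φ ψ
      have : (innerSL ℂ g).comp (tensL (μ := μ) ψ) = 0 := by
        apply ContinuousLinearMap.ext_on hden1
        rintro _ ⟨j, rfl⟩
        exact h1 j ψ
      exact congrArg (fun f => f φ) this
    rw [Submodule.mem_bot]
    apply eq_zero_of_tens
    intro φ ψ
    rw [← inner_conj_symm, h2, map_zero]
  exact ⟨HilbertBasis.mkOfOrthogonalEqBot ho hspan, fun i => by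
    rw [HilbertBasis.coe_mkOfOrthogonalEqBot]⟩

lemma T1_tens (k : X → X → ℂ) (K : Lp ℂ 2 μ →L[ℂ] Lp ℂ 2 μ)
    (T : Lp ℂ 2 (μ.prod ν) →L[ℂ] Lp ℂ 2 (μ.prod ν))
    (hK : ∀ φ : Lp ℂ 2 μ, (K φ : X → ℂ) =ᵐ[μ] fun x => ∫ s, k x s * φ s ∂μ)
    (hT : ∀ f : Lp ℂ 2 (μ.prod ν),
      (T f : X × Y → ℂ) =ᵐ[μ.prod ν] fun p => ∫ s, k p.1 s * f (s, p.2) ∂μ)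
    (φ : Lp ℂ 2 μ) (ψ : Lp ℂ 2 ν) : T (tens φ ψ) = tens (K φ) ψ := by
  apply Lp.ext
  have h0 : ∀ᵐ y ∂ν, ∀ᵐ s ∂μ, tens φ ψ (s, y) = φ s * ψ y := by
    have := Measure.measurePreserving_swap (μ := ν) (ν := μ) |>.quasiMeasurePreserving.ae
      (coe_tens φ ψ)
    exact Measure.ae_ae_of_ae_prod this
  filter_upwards [hT (tens φ ψ), coe_tens (K φ) ψ, ae_fst (ν := ν) (hK φ),
    ae_snd (μ := μ) h0] with p h1 h2 h3 h4
  rw [h1, h2, h3, ← integral_mul_const]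
  apply integral_congr_ae
  filter_upwards [h4] with s hs
  rw [hs]; ring

lemma T2_tens (k : Y → Y → ℂ) (K : Lp ℂ 2 ν →L[ℂ] Lp ℂ 2 ν)
    (T : Lp ℂ 2 (μ.prod ν) →L[ℂ] Lp ℂ 2 (μ.prod ν))
    (hK : ∀ φ : Lp ℂ 2 ν, (K φ : Y → ℂ) =ᵐ[ν] fun x => ∫ s, k x s * φ s ∂ν)
    (hT : ∀ f : Lp ℂ 2 (μ.prod ν),
      (T f : X × Y → ℂ) =ᵐ[μ.prod ν] fun p => ∫ t, k p.2 t * f (p.1, t) ∂ν)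
    (φ : Lp ℂ 2 μ) (ψ : Lp ℂ 2 ν) : T (tens φ ψ) = tens φ (K ψ) := by
  apply Lp.ext
  have h0 : ∀ᵐ x ∂μ, ∀ᵐ t ∂ν, tens φ ψ (x, t) = φ x * ψ t :=
    Measure.ae_ae_of_ae_prod (coe_tens φ ψ)
  filter_upwards [hT (tens φ ψ), coe_tens φ (K ψ), ae_snd (μ := μ) (hK ψ),
    ae_fst (ν := ν) h0] with p h1 h2 h3 h4
  rw [h1, h2, h3, ← integral_const_mul]
  apply integral_congr_ae
  filter_upwards [h4] with s hs
  rw [hs]; ring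

end Tensor

section Combinatorics

lemma compact_discrete {H : Type*} [NormedAddCommGroup H] [InnerProductSpace ℂ H] [CompleteSpace H]
    {ι : Type*} [Infinite ι] (b : HilbertBasis ι ℂ H) (K : H →L[ℂ] H)
    (a : ι → ℂ) (hA : ∀ i, K (b i) = a i • b i) (hfin : ∀ ε > 0, {i | ε ≤ ‖a i‖}.Finite) :
    spectrum ℂ K = insert 0 (discreteSpectrum K) ∧ (0 : ℂ) ∉ discreteSpectrum K := by
  have hco : ∀ ε > 0, {i | ‖a i‖ < ε}.Infinite := by
    intro ε hε
    have : {i | ‖a i‖ < ε} = {i | ε ≤ ‖a i‖}ᶜ := by ext i; simp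
    rw [this]
    exact (hfin ε hε).infinite_compl
  have h0 : (0 : ℂ) ∈ essSpectrum K := by
    rw [diag_mem_ess b K a hA]
    simpa using hco
  refine ⟨?_, h0.2⟩
  ext z
  rw [Set.mem_insert_iff]
  constructor
  · intro hz
    by_contra! hne
    have hess : z ∈ essSpectrum K := ⟨hz, hne.2⟩
    rw [diag_mem_ess b K a hA] at hess
    have hpos : 0 < ‖z‖ := norm_pos_iff.mpr hne.1
    refine hess (‖z‖ / 2) (by positivity) ((hfin (‖z‖ / 2) (by positivity)).subset ?_)
    intro i hi
    have hi : ‖a i - z‖ < ‖z‖ / 2 := hi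
    change ‖z‖ / 2 ≤ ‖a i‖
    have := norm_sub_norm_le z (a i)
    rw [norm_sub_rev] at this
    linarith
  · rintro (rfl | hz)
    · exact h0.1
    · exact hz.1.1

lemma ess_combinatorics {ι κ : Type*} [Infinite ι] [Infinite κ] (a : ι → ℂ) (c : κ → ℂ)
    (ha : ∀ ε > 0, {i | ε ≤ ‖a i‖}.Finite) (hc : ∀ ε > 0, {i | ε ≤ ‖c i‖}.Finite) (z : ℂ) :
    (∀ ε > 0, {i : ι × κ | ‖a i.1 + c i.2 - z‖ < ε}.Infinite) ↔
      (∀ ε > 0, ∃ i, ‖a i - z‖ < ε) ∨ (∀ ε > 0, ∃ i, ‖c i - z‖ < ε) := by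
  have hco : ∀ ε > 0, {i | ‖a i‖ < ε}.Infinite := by
    intro ε hε
    have : {i | ‖a i‖ < ε} = {i | ε ≤ ‖a i‖}ᶜ := by ext i; simp
    rw [this]
    exact (ha ε hε).infinite_compl
  have hco' : ∀ ε > 0, {i | ‖c i‖ < ε}.Infinite := by
    intro ε hε
    have : {i | ‖c i‖ < ε} = {i | ε ≤ ‖c i‖}ᶜ := by ext i; simp
    rw [this]
    exact (hc ε hε).infinite_compl
  constructor
  · intro h
    by_contra! hne
    obtain ⟨⟨ε, hε, h1⟩, ⟨δ, hδ, h2⟩⟩ := hne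
    have hm : 0 < min ε δ := lt_min hε hδ
    refine h (min ε δ / 2) (by positivity)
      (((ha (min ε δ / 2) (by positivity)).prod (hc (min ε δ / 2) (by positivity))).subset ?_)
    rintro ⟨i, j⟩ hij
    have hij : ‖a i + c j - z‖ < min ε δ / 2 := hij
    have e1 := (min_le_left ε δ).trans (h1 i)
    have e2 := (min_le_right ε δ).trans (h2 j)
    have t1 : ‖a i - z‖ ≤ ‖a i + c j - z‖ + ‖c j‖ := by
      have := norm_sub_le (a i + c j - z) (c j)
      rwa [show a i + c j - z - c j = a i - z by ring] at this
    have t2 : ‖c j - z‖ ≤ ‖a i + c j - z‖ + ‖a i‖ := by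
      have := norm_sub_le (a i + c j - z) (a i)
      rwa [show a i + c j - z - a i = c j - z by ring] at this
    refine ⟨?_, ?_⟩
    · change min ε δ / 2 ≤ ‖a i‖
      linarith
    · change min ε δ / 2 ≤ ‖c j‖
      linarith
  · rintro (h | h) ε hε
    · obtain ⟨i, hi⟩ := h (ε / 2) (by positivity)
      refine ((hco' (ε / 2) (by positivity)).image (f := fun j => (i, j))
        (fun x _ y _ hxy => (Prod.mk.inj hxy).2)).mono ?_
      rintro _ ⟨j, hj, rfl⟩
      have hj : ‖c j‖ < ε / 2 := hj
      change ‖a i + c j - z‖ < ε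
      rw [show a i + c j - z = (a i - z) + c j by ring]
      linarith [norm_add_le (a i - z) (c j)]
    · obtain ⟨j, hj⟩ := h (ε / 2) (by positivity)
      refine ((hco (ε / 2) (by positivity)).image (f := fun i => (i, j))
        (fun x _ y _ hxy => (Prod.mk.inj hxy).1)).mono ?_
      rintro _ ⟨i, hi, rfl⟩
      have hi : ‖a i‖ < ε / 2 := hi
      change ‖a i + c j - z‖ < ε
      rw [show a i + c j - z = (c j - z) + a i by ring]
      linarith [norm_add_le (c j - z) (a i)]

end Combinatorics

section Setting

variable {d₁ d₂ : ℕ}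
  {Ω₁ : Set (EuclideanSpace ℝ (Fin d₁))} {Ω₂ : Set (EuclideanSpace ℝ (Fin d₂))}

/-- **Proposition 3.1 (а),(б).** Cardinality estimates relating the essential spectrum of
`T = T₁ + T₂` and the discrete spectra of the compact integral operators `K₁`, `K₂`. -/
theorem card_essSpectrum_T
    (ν₁ : Measure Ω₁) (ν₂ : Measure Ω₂) [IsFiniteMeasure ν₁] [IsFiniteMeasure ν₂]
    (k₁ : Ω₁ → Ω₁ → ℂ) (k₂ : Ω₂ → Ω₂ → ℂ)
    (K₁ : Lp ℂ 2 ν₁ →L[ℂ] Lp ℂ 2 ν₁) (K₂ : Lp ℂ 2 ν₂ →L[ℂ] Lp ℂ 2 ν₂)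
    (T₁ T₂ : Lp ℂ 2 (ν₁.prod ν₂) →L[ℂ] Lp ℂ 2 (ν₁.prod ν₂))
    (hΩ₁ : IsCompact Ω₁) (hΩ₂ : IsCompact Ω₂)
    (hk₁c : Continuous fun p : Ω₁ × Ω₁ => k₁ p.1 p.2)
    (hk₂c : Continuous fun p : Ω₂ × Ω₂ => k₂ p.1 p.2)
    (hk₁h : ∀ x s, k₁ x s = starRingEnd ℂ (k₁ s x))
    (hk₂h : ∀ y t, k₂ y t = starRingEnd ℂ (k₂ t y))
    (hK₁ : ∀ φ : Lp ℂ 2 ν₁, (K₁ φ : Ω₁ → ℂ) =ᵐ[ν₁] fun x => ∫ s, k₁ x s * φ s ∂ν₁)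
    (hK₂ : ∀ φ : Lp ℂ 2 ν₂, (K₂ φ : Ω₂ → ℂ) =ᵐ[ν₂] fun y => ∫ t, k₂ y t * φ t ∂ν₂)
    (hK₁sa : IsSelfAdjoint K₁) (hK₂sa : IsSelfAdjoint K₂)
    (hK₁cpt : IsCompactOperator K₁) (hK₂cpt : IsCompactOperator K₂)
    (hT₁ : ∀ f : Lp ℂ 2 (ν₁.prod ν₂),
      (T₁ f : Ω₁ × Ω₂ → ℂ) =ᵐ[ν₁.prod ν₂] fun p => ∫ s, k₁ p.1 s * f (s, p.2) ∂ν₁)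
    (hT₂ : ∀ f : Lp ℂ 2 (ν₁.prod ν₂),
      (T₂ f : Ω₁ × Ω₂ → ℂ) =ᵐ[ν₁.prod ν₂] fun p => ∫ t, k₂ p.2 t * f (p.1, t) ∂ν₂)
    (hinf₁ : ¬ FiniteDimensional ℂ (Lp ℂ 2 ν₁))
    (hinf₂ : ¬ FiniteDimensional ℂ (Lp ℂ 2 ν₂)) :
    Cardinal.mk (discreteSpectrum K₁) + 1 ≤ Cardinal.mk (essSpectrum (T₁ + T₂)) ∧
    Cardinal.mk (discreteSpectrum K₂) + 1 ≤ Cardinal.mk (essSpectrum (T₁ + T₂)) ∧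
    Cardinal.mk (essSpectrum (T₁ + T₂)) ≤
      Cardinal.mk (discreteSpectrum K₁) + Cardinal.mk (discreteSpectrum K₂) + 1 := by
  obtain ⟨ι, b, a, hι, hb, ha⟩ := compact_diag K₁ hK₁cpt hK₁sa hinf₁
  obtain ⟨κ, c, m, hκ, hc, hm⟩ := compact_diag K₂ hK₂cpt hK₂sa hinf₂
  obtain ⟨B, hB⟩ := exists_tens_basis b c
  have hT : ∀ i, (T₁ + T₂) (B i) = (a i.1 + m i.2) • B i := by
    intro i
    rw [hB, _root_.add_apply, T1_tens k₁ K₁ T₁ hK₁ hT₁, T2_tens k₂ K₂ T₂ hK₂ hT₂, hb, hc,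
      tens_smul_left, tens_smul_right, add_smul]
  have hess : essSpectrum (T₁ + T₂) = spectrum ℂ K₁ ∪ spectrum ℂ K₂ := by
    ext z
    rw [diag_mem_ess B _ _ hT, ess_combinatorics a m ha hm, Set.mem_union,
      diag_mem_spectrum b K₁ a hb, diag_mem_spectrum c K₂ m hc]
  obtain ⟨h1, h1'⟩ := compact_discrete b K₁ a hb ha
  obtain ⟨h2, h2'⟩ := compact_discrete c K₂ m hc hm
  rw [hess]
  refine ⟨?_, ?_, ?_⟩
  · rw [← Cardinal.mk_insert h1', ← h1]
    exact Cardinal.mk_le_mk_of_subset Set.subset_union_left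
  · rw [← Cardinal.mk_insert h2', ← h2]
    exact Cardinal.mk_le_mk_of_subset Set.subset_union_right
  · rw [h1, h2, ← Set.insert_union_distrib]
    exact Cardinal.mk_insert_le.trans (by gcongr; exact Cardinal.mk_union_le _ _)

end Setting

end
end

section
/- Assume L²(Ω₁,ν₁) and L²(Ω₂,ν₂) are infinite-dimensional and K₁ ≠ 0 and K₂ ≠ 0. Then the discrete spectrum σ_d(T) of T is an infinite set if and only if σ_d(K₁) is infinite or σ_d(K₂) is infinite. Moreover (without assuming K₁, K₂ ≠ 0), the essential spectrum σ_e(T) is an infinite set if and only if σ_d(K₁) is infinite or σ_d(K₂) is infinite. -/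
open MeasureTheory Filter Topology Metric

noncomputable section

variable {𝓗 : Type*} [NormedAddCommGroup 𝓗] [InnerProductSpace ℂ 𝓗]

open Module.End in
theorem aux_spectrum_subset [CompleteSpace 𝓗] (A : 𝓗 →L[ℂ] 𝓗)
    (hA : (A : 𝓗 →ₗ[ℂ] 𝓗).IsSymmetric) (C : Set ℂ) (hC : IsClosed C)
    (hd : ∀ w, (∀ c ∈ C, ∀ v ∈ eigenspace (A : 𝓗 →ₗ[ℂ] 𝓗) c, inner ℂ v w = 0) → w = 0) :
    spectrum ℂ A ⊆ C := by
  intro z hz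
  by_contra hzC
  apply hz
  obtain ⟨δ, hδ, hball⟩ := Metric.isOpen_iff.1 hC.isOpen_compl z hzC
  have hdist : ∀ c ∈ C, δ ≤ ‖z - c‖ := by
    intro c hc
    by_contra h
    push Not at h
    exact hball (by rw [Metric.mem_ball, dist_comm, dist_eq_norm]; exact h) hc
  set V : C → Submodule ℂ 𝓗 := fun c => eigenspace (A : 𝓗 →ₗ[ℂ] 𝓗) (c : ℂ) with hV
  have hOF : OrthogonalFamily ℂ (fun c : C => V c) fun c => (V c).subtypeₗᵢ :=
    hA.orthogonalFamily_eigenspaces.comp Subtype.coe_injective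
  have hperp : (⨆ c, V c)ᗮ = ⊥ := by
    rw [Submodule.eq_bot_iff]
    intro w hw
    apply hd
    intro c hc v hv
    exact hw v (Submodule.mem_iSup_of_mem (⟨c, hc⟩ : C) hv)
  have hdense : (⨆ c, V c).topologicalClosure = ⊤ :=
    Submodule.topologicalClosure_eq_top_iff.2 hperp
  set B : 𝓗 →L[ℂ] 𝓗 := algebraMap ℂ (𝓗 →L[ℂ] 𝓗) z - A with hB
  have hBv : ∀ c : C, ∀ v ∈ V c, B v = (z - c) • v := by
    intro c v hv
    have : A v = (c : ℂ) • v := mem_eigenspace_iff.1 hv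
    simp [hB, this, Algebra.algebraMap_eq_smul_one, sub_smul]
  have hne : ∀ c : C, z - c ≠ 0 := fun c h => by
    have := hdist c c.2
    rw [h, norm_zero] at this
    linarith
  have hbd : ∀ v, δ * ‖v‖ ≤ ‖B v‖ := by
    have hcl : IsClosed {v | δ * ‖v‖ ≤ ‖B v‖} := isClosed_le (by fun_prop) (by fun_prop)
    have hsub : ((⨆ c, V c : Submodule ℂ 𝓗) : Set 𝓗) ⊆ {v | δ * ‖v‖ ≤ ‖B v‖} := by
      intro v hv
      obtain ⟨f, hf, rfl⟩ := (Submodule.mem_iSup_iff_exists_finsupp V v).1 hv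
      have h1 := hOF.norm_sum (fun c => ⟨f c, hf c⟩) f.support
      have h2 := hOF.norm_sum (fun c => ⟨(z - c) • f c, (V c).smul_mem _ (hf c)⟩) f.support
      simp only [Submodule.coe_subtypeₗᵢ, Submodule.subtype_apply, Submodule.coe_norm] at h1 h2
      have h3 : B (f.sum fun _ xi => xi) = ∑ c ∈ f.support, (z - c) • f c := by
        rw [Finsupp.sum, map_sum]
        exact Finset.sum_congr rfl fun c _ => hBv c _ (hf c)
      simp only [Set.mem_ofPred_eq]
      rw [h3]
      apply le_of_sq_le_sq _ (norm_nonneg _)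
      rw [mul_pow, h2, Finsupp.sum, h1, Finset.mul_sum]
      apply Finset.sum_le_sum
      intro c _
      rw [norm_smul, mul_pow]
      have := hdist c c.2
      gcongr
    intro v
    have : v ∈ closure ((⨆ c, V c : Submodule ℂ 𝓗) : Set 𝓗) := by
      rw [← Submodule.topologicalClosure_coe, hdense]; trivial
    exact (hcl.closure_subset_iff.2 hsub) this
  change IsUnit B
  rw [ContinuousLinearMap.isUnit_iff_bijective,
    ContinuousLinearMap.bijective_iff_dense_range_and_antilipschitz]
  constructor
  · rw [eq_top_iff, ← hdense]
    apply Submodule.topologicalClosure_mono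
    apply iSup_le
    intro c v hv
    refine ⟨(z - c)⁻¹ • v, ?_⟩
    change B _ = v
    rw [map_smul, hBv c v hv, smul_smul, inv_mul_cancel₀ (hne c), one_smul]
  · refine ⟨Real.toNNReal δ⁻¹, ?_⟩
    apply AddMonoidHomClass.antilipschitz_of_bound
    intro x
    have := hbd x
    rw [Real.coe_toNNReal _ (inv_nonneg.2 hδ.le), inv_mul_eq_div, le_div_iff₀ hδ]
    linarith

theorem aux_isSymmetric [CompleteSpace 𝓗] {K : 𝓗 →L[ℂ] 𝓗} (h : IsSelfAdjoint K) :
    (K : 𝓗 →ₗ[ℂ] 𝓗).IsSymmetric := by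
  exact ContinuousLinearMap.isSelfAdjoint_iff_isSymmetric.1 h

open Module.End in
theorem aux_finite_away [CompleteSpace 𝓗] (K : 𝓗 →L[ℂ] 𝓗)
    (hK : IsCompactOperator K) (hs : (K : 𝓗 →ₗ[ℂ] 𝓗).IsSymmetric) (r : ℝ) (hr : 0 < r) :
    {z | z ∈ spectrum ℂ K ∧ r ≤ ‖z‖}.Finite := by
  by_contra hinf
  have hinf : {z | z ∈ spectrum ℂ K ∧ r ≤ ‖z‖}.Infinite := hinf
  set l := hinf.natEmbedding with hl
  have hev : ∀ n, ∃ v : 𝓗, ‖v‖ = 1 ∧ K v = (l n : ℂ) • v := by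
    intro n
    have h0 : (l n : ℂ) ≠ 0 := by
      intro h
      have := (l n).2.2
      rw [h, norm_zero] at this
      linarith
    obtain ⟨v, hv⟩ := ((hK.hasEigenvalue_iff_mem_spectrum h0).2 (l n).2.1).exists_hasEigenvector
    have hvn : ‖v‖ ≠ 0 := norm_ne_zero_iff.2 hv.2
    refine ⟨((‖v‖⁻¹ : ℝ) : ℂ) • v, ?_, ?_⟩
    · rw [norm_smul]; simp [hvn]
    · have := hv.apply_eq_smul
      rw [map_smul]
      change _ • ((K : 𝓗 →ₗ[ℂ] 𝓗) v) = _
      rw [this, smul_comm]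
  choose e he hKe using hev
  have horth : ∀ m n, m ≠ n → inner ℂ (e m) (e n) = 0 := by
    intro m n hmn
    have := hs.orthogonalFamily_eigenspaces (i := l m) (j := l n)
      (fun h => hmn (l.injective (Subtype.ext h)))
      ⟨e m, mem_eigenspace_iff.2 (hKe m)⟩ ⟨e n, mem_eigenspace_iff.2 (hKe n)⟩
    simpa using this
  have hsep : ∀ m n, m ≠ n → r ≤ dist (K (e m)) (K (e n)) := by
    intro m n hmn
    rw [dist_eq_norm]
    apply le_of_sq_le_sq _ (norm_nonneg _)
    have h1 : ‖K (e m) - K (e n)‖ ^ 2 = ‖K (e m)‖ ^ 2 + ‖K (e n)‖ ^ 2 := by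
      rw [@norm_sub_sq ℂ, hKe, hKe, inner_smul_left, inner_smul_right, horth m n hmn]
      simp
    rw [h1, hKe, norm_smul, he, mul_one]
    have := (l m).2.2
    have h3 : r ^ 2 ≤ ‖(l m : ℂ)‖ ^ 2 := by gcongr
    nlinarith [sq_nonneg ‖K (e n)‖]
  obtain ⟨S, hS, hsub⟩ := hK.image_closedBall_subset_compact (𝕜₁ := ℂ) (f := (K : 𝓗 →ₗ[ℂ] 𝓗)) 1
  obtain ⟨a, -, φ, hφ, hlim⟩ := hS.tendsto_subseq (x := fun n => K (e n))
    (fun n => hsub ⟨e n, by simp [he], rfl⟩)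
  obtain ⟨N, hN⟩ := Metric.cauchySeq_iff'.1 hlim.cauchySeq r hr
  have h1 := hN (N + 1) (by omega)
  have h2 := hsep (φ (N + 1)) (φ N) (fun h => by have := hφ.injective h; omega)
  simp only [Function.comp] at h1
  linarith

theorem aux_zero_mem [CompleteSpace 𝓗] (K : 𝓗 →L[ℂ] 𝓗)
    (hK : IsCompactOperator K) (hinf : ¬ FiniteDimensional ℂ 𝓗) : (0 : ℂ) ∈ spectrum ℂ K := by
  rw [spectrum.zero_mem_iff]
  rintro ⟨u, hu⟩
  apply hinf
  rw [← isCompactOperator_id_iff_finiteDimensional]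
  have := hK.clm_comp (↑u⁻¹ : 𝓗 →L[ℂ] 𝓗)
  have h2 : (↑u⁻¹ : 𝓗 →L[ℂ] 𝓗) * K = 1 := by rw [← hu, Units.inv_mul]
  have h3 : ((↑u⁻¹ : 𝓗 →L[ℂ] 𝓗) ∘ K : 𝓗 → 𝓗) = _root_.id := by
    funext x
    have := congrArg (fun f : 𝓗 →L[ℂ] 𝓗 => f x) h2
    exact this
  rwa [h3] at this

theorem aux_eig_mem (K : 𝓗 →L[ℂ] 𝓗) {z : ℂ}
    {v : 𝓗} (hv : K v = z • v) (h0 : v ≠ 0) : z ∈ spectrum ℂ K := by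
  intro hu
  obtain ⟨u, hu⟩ := hu
  apply h0
  have h1 : (u : 𝓗 →L[ℂ] 𝓗) v = 0 := by
    rw [hu]; simp [Algebra.algebraMap_eq_smul_one, hv]
  have h2 : (↑u⁻¹ : 𝓗 →L[ℂ] 𝓗) * u = 1 := Units.inv_mul u
  have h3 : (↑u⁻¹ : 𝓗 →L[ℂ] 𝓗) ((u : 𝓗 →L[ℂ] 𝓗) v) = v :=
    congrArg (fun f : 𝓗 →L[ℂ] 𝓗 => f v) h2
  rw [← h3, h1, map_zero]

open Module.End in
theorem aux_spec_closure [CompleteSpace 𝓗] (K : 𝓗 →L[ℂ] 𝓗)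
    (hK : IsCompactOperator K) (hs : (K : 𝓗 →ₗ[ℂ] 𝓗).IsSymmetric) :
    spectrum ℂ K ⊆ closure {z | HasEigenvalue (K : 𝓗 →ₗ[ℂ] 𝓗) z} := by
  apply aux_spectrum_subset K hs _ isClosed_closure
  intro w hw
  have h := ContinuousLinearMap.orthogonalComplement_iSup_eigenspaces_eq_bot hK hs
  rw [Submodule.eq_bot_iff] at h
  apply h
  rw [← Submodule.iInf_orthogonal, Submodule.mem_iInf]
  intro c v hv
  by_cases hc : HasEigenvalue (K : 𝓗 →ₗ[ℂ] 𝓗) c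
  · exact hw c (subset_closure hc) v hv
  · rw [hasEigenvalue_iff, not_not] at hc
    rw [hc] at hv
    rw [(Submodule.mem_bot ℂ).1 hv, inner_zero_left]

/-- finite spectrum implies infinite-dimensional kernel -/
theorem aux_ker_inf [CompleteSpace 𝓗] (K : 𝓗 →L[ℂ] 𝓗)
    (hK : IsCompactOperator K) (hs : (K : 𝓗 →ₗ[ℂ] 𝓗).IsSymmetric)
    (hinf : ¬ FiniteDimensional ℂ 𝓗) (hfin : (spectrum ℂ K).Finite) :
    ¬ FiniteDimensional ℂ (Module.End.eigenspace (K : 𝓗 →ₗ[ℂ] 𝓗) 0) := by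
  intro hker
  apply hinf
  have h := ContinuousLinearMap.orthogonalComplement_iSup_eigenspaces_eq_bot hK hs
  have hF : ∀ c : spectrum ℂ K,
      FiniteDimensional ℂ (Module.End.eigenspace (K : 𝓗 →ₗ[ℂ] 𝓗) (c : ℂ)) := by
    intro c
    by_cases hc : (c : ℂ) = 0
    · rw [hc]; exact hker
    · exact ContinuousLinearMap.finite_dimensional_eigenspace hK c hc
  have : Finite (spectrum ℂ K) := hfin
  set F : Submodule ℂ 𝓗 := ⨆ c : spectrum ℂ K, Module.End.eigenspace (K : 𝓗 →ₗ[ℂ] 𝓗) (c : ℂ)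
    with hFdef
  have hFf : FiniteDimensional ℂ F := Submodule.finiteDimensional_iSup _
  have hle : (⨆ μ, Module.End.eigenspace (K : 𝓗 →ₗ[ℂ] 𝓗) μ) ≤ F := by
    apply iSup_le
    intro c v hv
    by_cases hv0 : v = 0
    · rw [hv0]; exact F.zero_mem
    · exact Submodule.mem_iSup_of_mem
        (⟨c, aux_eig_mem K (Module.End.mem_eigenspace_iff.1 hv) hv0⟩ : spectrum ℂ K) hv
  have hFb : Fᗮ = ⊥ := by
    rw [eq_bot_iff, ← h]
    exact Submodule.orthogonal_le hle
  have : F = ⊤ := Submodule.orthogonal_eq_bot_iff.1 hFb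
  rw [this] at hFf
  exact Module.finite_def.2 (Module.Finite.iff_fg.1 hFf)

theorem aux_small [CompleteSpace 𝓗] (K : 𝓗 →L[ℂ] 𝓗)
    (hK : IsCompactOperator K) (hs : (K : 𝓗 →ₗ[ℂ] 𝓗).IsSymmetric)
    (hinf : (spectrum ℂ K).Infinite) (ε : ℝ) (hε : 0 < ε) :
    ∃ z ∈ spectrum ℂ K, z ≠ 0 ∧ ‖z‖ < ε := by
  obtain ⟨z, hz, hz2⟩ := hinf.exists_notMem_finite
    ((aux_finite_away K hK hs ε hε).union (Set.finite_singleton 0))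
  refine ⟨z, hz, fun h => hz2 (Or.inr h), ?_⟩
  by_contra h
  push Not at h
  exact hz2 (Or.inl ⟨hz, h⟩)

theorem aux_isolated_of_finite {S : Set ℂ} {z : ℂ} (hz : z ∈ S) {r : ℝ} (hr : 0 < r)
    (hf : (S ∩ Metric.ball z r).Finite) : IsIsolatedIn S z := by
  refine ⟨hz, ?_⟩
  have hcl : IsClosed ((S ∩ Metric.ball z r) \ {z}) := (hf.subset Set.sdiff_subset).isClosed
  obtain ⟨δ, hδ, hb⟩ := Metric.isOpen_iff.1 hcl.isOpen_compl z (fun h => h.2 rfl)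
  refine ⟨min δ r, lt_min hδ hr, ?_⟩
  ext w
  constructor
  · rintro ⟨hw, hw2⟩
    by_contra hne
    exact hb (Metric.ball_subset_ball (min_le_left _ _) hw2)
      ⟨⟨hw, Metric.ball_subset_ball (min_le_right _ _) hw2⟩, hne⟩
  · rintro rfl
    exact ⟨hz, Metric.mem_ball_self (lt_min hδ hr)⟩

theorem aux_disc_infinite_iff [CompleteSpace 𝓗] (K : 𝓗 →L[ℂ] 𝓗)
    (hK : IsCompactOperator K) (hs : (K : 𝓗 →ₗ[ℂ] 𝓗).IsSymmetric) :
    (discreteSpectrum K).Infinite ↔ (spectrum ℂ K).Infinite := by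
  constructor
  · intro h
    exact h.mono fun z hz => hz.1.1
  · intro h
    refine (h.sdiff (Set.finite_singleton 0)).mono ?_
    rintro z ⟨hz, hz0⟩
    have hz0 : z ≠ 0 := hz0
    have hzn : 0 < ‖z‖ := norm_pos_iff.2 hz0
    refine ⟨aux_isolated_of_finite hz (half_pos hzn) ?_,
      (hK.hasEigenvalue_iff_mem_spectrum hz0).2 hz,
      ContinuousLinearMap.finite_dimensional_eigenspace hK z hz0⟩
    refine (aux_finite_away K hK hs (‖z‖ / 2) (half_pos hzn)).subset ?_
    rintro w ⟨hw, hwb⟩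
    refine ⟨hw, ?_⟩
    rw [Metric.mem_ball, dist_comm, dist_eq_norm] at hwb
    have := norm_sub_norm_le z w
    linarith

/-- Abstract tensor product data. -/
structure AuxTens {H₁ H₂ H : Type*} [NormedAddCommGroup H₁] [InnerProductSpace ℂ H₁]
    [NormedAddCommGroup H₂] [InnerProductSpace ℂ H₂]
    [NormedAddCommGroup H] [InnerProductSpace ℂ H]
    (tp : H₁ →ₗ[ℂ] H₂ →ₗ[ℂ] H) (K₁ : H₁ →L[ℂ] H₁) (K₂ : H₂ →L[ℂ] H₂) (T : H →L[ℂ] H) :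
    Prop where
  inn : ∀ a b c d, inner ℂ (tp a b) (tp c d) = inner ℂ a c * inner ℂ b d
  dense : ∀ w, (∀ a b, inner ℂ (tp a b) w = 0) → w = 0
  act : ∀ a b, T (tp a b) = tp (K₁ a) b + tp a (K₂ b)
  c₁ : IsCompactOperator K₁
  c₂ : IsCompactOperator K₂
  s₁ : (K₁ : H₁ →ₗ[ℂ] H₁).IsSymmetric
  s₂ : (K₂ : H₂ →ₗ[ℂ] H₂).IsSymmetric
  i₁ : ¬ FiniteDimensional ℂ H₁
  i₂ : ¬ FiniteDimensional ℂ H₂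

namespace AuxTens

set_option linter.unusedSectionVars false

variable {H₁ H₂ H : Type*} [NormedAddCommGroup H₁] [InnerProductSpace ℂ H₁]
    [NormedAddCommGroup H₂] [InnerProductSpace ℂ H₂]
    [NormedAddCommGroup H] [InnerProductSpace ℂ H]
    [CompleteSpace H₁] [CompleteSpace H₂] [CompleteSpace H]
    {tp : H₁ →ₗ[ℂ] H₂ →ₗ[ℂ] H} {K₁ : H₁ →L[ℂ] H₁} {K₂ : H₂ →L[ℂ] H₂} {T : H →L[ℂ] H}

theorem swap (h : AuxTens tp K₁ K₂ T) : AuxTens tp.flip K₂ K₁ T where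
  inn a b c d := by simp [h.inn, mul_comm]
  dense w hw := h.dense w fun a b => hw b a
  act a b := by simp [h.act, add_comm]
  c₁ := h.c₂
  c₂ := h.c₁
  s₁ := h.s₂
  s₂ := h.s₁
  i₁ := h.i₂
  i₂ := h.i₁

theorem nrm (h : AuxTens tp K₁ K₂ T) (a : H₁) (b : H₂) : ‖tp a b‖ = ‖a‖ * ‖b‖ := by
  have h1 := h.inn a b a b
  rw [inner_self_eq_norm_sq_to_K, inner_self_eq_norm_sq_to_K, inner_self_eq_norm_sq_to_K,
    ← mul_pow] at h1
  have h2 : ‖tp a b‖ ^ 2 = (‖a‖ * ‖b‖) ^ 2 := by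
    have h3 : ((‖tp a b‖ ^ 2 : ℝ) : ℂ) = (((‖a‖ * ‖b‖) ^ 2 : ℝ) : ℂ) := by
      push_cast
      exact h1
    exact_mod_cast h3
  exact (pow_left_inj₀ (norm_nonneg _) (by positivity) two_ne_zero).1 h2

theorem ne_zero (h : AuxTens tp K₁ K₂ T) {a : H₁} {b : H₂} (ha : a ≠ 0) (hb : b ≠ 0) :
    tp a b ≠ 0 := by
  rw [← norm_ne_zero_iff, h.nrm]
  exact mul_ne_zero (norm_ne_zero_iff.2 ha) (norm_ne_zero_iff.2 hb)

theorem eig (h : AuxTens tp K₁ K₂ T) {a : H₁} {b : H₂} {l m : ℂ} (ha : K₁ a = l • a)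
    (hb : K₂ b = m • b) : T (tp a b) = (l + m) • tp a b := by
  rw [h.act, ha, hb, map_smul, map_smul, LinearMap.smul_apply, add_smul]

theorem left_dense (h : AuxTens tp K₁ K₂ T) (b : H₂) (w : H)
    (hw : ∀ l : ℂ, ∀ a, K₁ a = l • a → inner ℂ (tp a b) w = 0) (a : H₁) :
    inner ℂ (tp a b) w = 0 := by
  have hcont : Continuous (tp.flip b) :=
    (LinearMap.mkContinuous (tp.flip b) ‖b‖ (fun a => by
      rw [LinearMap.flip_apply, h.nrm, mul_comm])).continuous
  have hc : Continuous fun a => inner ℂ w (tp a b) := by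
    have : Continuous fun a => tp a b := hcont
    fun_prop
  set S : Submodule ℂ H₁ := LinearMap.ker ((innerSL ℂ w).toLinearMap ∘ₗ tp.flip b) with hS
  have hmem : ∀ a, a ∈ S ↔ inner ℂ w (tp a b) = 0 := by
    intro a; simp [hS]
  have hcl : IsClosed (S : Set H₁) := by
    have : (S : Set H₁) = (fun a => inner ℂ w (tp a b)) ⁻¹' {0} := by
      ext a; exact hmem a
    rw [this]
    exact isClosed_singleton.preimage hc
  have hle : (⨆ μ, Module.End.eigenspace (K₁ : H₁ →ₗ[ℂ] H₁) μ) ≤ S := by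
    apply iSup_le
    intro c v hv
    rw [hmem]
    exact inner_eq_zero_symm.1 (hw c v (Module.End.mem_eigenspace_iff.1 hv))
  have hbot := ContinuousLinearMap.orthogonalComplement_iSup_eigenspaces_eq_bot h.c₁ h.s₁
  have htop := Submodule.topologicalClosure_eq_top_iff.2 hbot
  have : a ∈ S := by
    have h2 := Submodule.topologicalClosure_minimal _ hle hcl
    rw [htop] at h2
    exact h2 trivial
  exact inner_eq_zero_symm.1 ((hmem a).1 this)

theorem eig_dense (h : AuxTens tp K₁ K₂ T) (w : H)
    (hw : ∀ l m : ℂ, ∀ a b, K₁ a = l • a → K₂ b = m • b → inner ℂ (tp a b) w = 0) : w = 0 := by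
  apply h.dense
  intro a b
  refine h.left_dense b w ?_ a
  intro l a ha
  exact h.swap.left_dense a w (fun m b hb => hw l m a b ha hb) b

theorem symT (h : AuxTens tp K₁ K₂ T) : (T : H →ₗ[ℂ] H).IsSymmetric := by
  have h1 : ∀ a b c d, inner ℂ (T (tp a b)) (tp c d) = inner ℂ (tp a b) (T (tp c d)) := by
    intro a b c d
    have e1 : inner ℂ (K₁ a) c = inner ℂ a (K₁ c) := h.s₁ a c
    have e2 : inner ℂ (K₂ b) d = inner ℂ b (K₂ d) := h.s₂ b d
    simp only [h.act, inner_add_left, inner_add_right, h.inn, e1, e2]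
  have h2 : ∀ c d, ContinuousLinearMap.adjoint T (tp c d) = T (tp c d) := by
    intro c d
    rw [← sub_eq_zero]
    apply h.dense
    intro a b
    rw [inner_sub_right, ContinuousLinearMap.adjoint_inner_right, h1, sub_self]
  have h3 : ContinuousLinearMap.adjoint T = T := by
    ext x
    rw [← sub_eq_zero]
    apply h.dense
    intro a b
    rw [inner_sub_right, ContinuousLinearMap.adjoint_inner_right, ← h2,
      ContinuousLinearMap.adjoint_inner_left, sub_self]
  exact aux_isSymmetric h3

theorem spec_sub (h : AuxTens tp K₁ K₂ T) {z : ℂ} (hz : z ∈ spectrum ℂ T) :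
    ∃ l ∈ spectrum ℂ K₁, ∃ m ∈ spectrum ℂ K₂, l + m = z := by
  have hc : IsCompact ((fun p : ℂ × ℂ => p.1 + p.2) '' (spectrum ℂ K₁ ×ˢ spectrum ℂ K₂)) :=
    ((spectrum.isCompact K₁).prod (spectrum.isCompact K₂)).image continuous_add
  have := aux_spectrum_subset T h.symT _ hc.isClosed ?_ hz
  · obtain ⟨⟨l, m⟩, ⟨h1, h2⟩, h3⟩ := this
    exact ⟨l, h1, m, h2, h3⟩
  · intro w hw
    apply h.eig_dense
    intro l m a b ha hb
    by_cases ha0 : a = 0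
    · simp [ha0]
    by_cases hb0 : b = 0
    · simp [hb0]
    exact hw (l + m) ⟨(l, m), ⟨aux_eig_mem K₁ ha ha0, aux_eig_mem K₂ hb hb0⟩, rfl⟩ _
      (Module.End.mem_eigenspace_iff.2 (h.eig ha hb))

theorem sub_spec (h : AuxTens tp K₁ K₂ T) {l m : ℂ} (hl : l ∈ spectrum ℂ K₁)
    (hm : m ∈ spectrum ℂ K₂) : l + m ∈ spectrum ℂ T := by
  rw [← (spectrum.isClosed T).closure_eq]
  refine map_mem_closure₂ continuous_add (aux_spec_closure K₁ h.c₁ h.s₁ hl)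
    (aux_spec_closure K₂ h.c₂ h.s₂ hm) ?_
  intro l hl m hm
  obtain ⟨a, ha⟩ := Module.End.HasEigenvalue.exists_hasEigenvector hl
  obtain ⟨b, hb⟩ := Module.End.HasEigenvalue.exists_hasEigenvector hm
  exact aux_eig_mem T (h.eig ha.apply_eq_smul hb.apply_eq_smul) (h.ne_zero ha.2 hb.2)

theorem not_disc (h : AuxTens tp K₁ K₂ T) {l : ℂ} (hl : l ∈ spectrum ℂ K₁) :
    l ∉ discreteSpectrum T := by
  rintro ⟨⟨-, ε, hε, hiso⟩, -, hfd⟩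
  have key : ∀ m : ℂ, l + m ∈ spectrum ℂ T → ‖m‖ < ε → m = 0 := by
    intro m hm hmε
    have : l + m ∈ ({l} : Set ℂ) := by
      rw [← hiso]
      exact ⟨hm, by simpa [Metric.mem_ball, dist_eq_norm] using hmε⟩
    simpa using this
  by_cases hB : (spectrum ℂ K₂).Finite
  · by_cases he : Module.End.HasEigenvalue (K₁ : H₁ →ₗ[ℂ] H₁) l
    · obtain ⟨a, ha⟩ := he.exists_hasEigenvector
      apply aux_ker_inf K₂ h.c₂ h.s₂ h.i₂ hB
      have hmaps : ∀ b ∈ Module.End.eigenspace (K₂ : H₂ →ₗ[ℂ] H₂) 0,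
          tp a b ∈ Module.End.eigenspace (T : H →ₗ[ℂ] H) l := by
        intro b hb
        rw [Module.End.mem_eigenspace_iff] at hb ⊢
        have := h.eig ha.apply_eq_smul hb
        rwa [add_zero] at this
      refine Module.Finite.of_injective ((tp a).restrict hmaps) ?_
      rw [← LinearMap.ker_eq_bot, LinearMap.ker_eq_bot']
      rintro ⟨b, hb⟩ hb0
      have hb0 : tp a b = 0 := congrArg Subtype.val hb0
      by_contra hne
      exact h.ne_zero ha.2 (fun hh => hne (Subtype.ext hh)) hb0
    · have hl0 : l = 0 := by
        by_contra hl0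
        exact he ((h.c₁.hasEigenvalue_iff_mem_spectrum hl0).2 hl)
      subst hl0
      by_cases hA : (spectrum ℂ K₁).Finite
      · apply aux_ker_inf K₁ h.c₁ h.s₁ h.i₁ hA
        rw [Module.End.hasEigenvalue_iff, not_not] at he
        rw [he]
        infer_instance
      · obtain ⟨m, hm, hm0, hmε⟩ := aux_small K₁ h.c₁ h.s₁ hA ε hε
        refine hm0 (key m ?_ hmε)
        have := h.sub_spec hm (aux_zero_mem K₂ h.c₂ h.i₂)
        rwa [add_comm] at this
  · obtain ⟨m, hm, hm0, hmε⟩ := aux_small K₂ h.c₂ h.s₂ hB ε hε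
    exact hm0 (key m (h.sub_spec hl hm) hmε)

theorem disc (h : AuxTens tp K₁ K₂ T) {z : ℂ} (hz : z ∈ spectrum ℂ T)
    (hz₁ : z ∉ spectrum ℂ K₁) (hz₂ : z ∉ spectrum ℂ K₂) : z ∈ discreteSpectrum T := by
  obtain ⟨δ₁, hδ₁, hb₁⟩ := Metric.isOpen_iff.1 (spectrum.isClosed K₁).isOpen_compl z hz₁
  obtain ⟨δ₂, hδ₂, hb₂⟩ := Metric.isOpen_iff.1 (spectrum.isClosed K₂).isOpen_compl z hz₂
  set r := min δ₁ δ₂ / 2 with hr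
  have hrpos : 0 < r := half_pos (lt_min hδ₁ hδ₂)
  have hd₁ : ∀ l ∈ spectrum ℂ K₁, 2 * r ≤ ‖l - z‖ := by
    intro l hl
    by_contra hlt
    push Not at hlt
    refine hb₁ ?_ hl
    rw [Metric.mem_ball, dist_eq_norm]
    have := min_le_left δ₁ δ₂
    linarith
  have hd₂ : ∀ l ∈ spectrum ℂ K₂, 2 * r ≤ ‖l - z‖ := by
    intro l hl
    by_contra hlt
    push Not at hlt
    refine hb₂ ?_ hl
    rw [Metric.mem_ball, dist_eq_norm]
    have := min_le_right δ₁ δ₂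
    linarith
  set A := {l | l ∈ spectrum ℂ K₁ ∧ r ≤ ‖l‖} with hA
  set B := {l | l ∈ spectrum ℂ K₂ ∧ r ≤ ‖l‖} with hB
  have hAf : A.Finite := aux_finite_away K₁ h.c₁ h.s₁ r hrpos
  have hBf : B.Finite := aux_finite_away K₂ h.c₂ h.s₂ r hrpos
  have hclose : ∀ l ∈ spectrum ℂ K₁, ∀ m ∈ spectrum ℂ K₂, ‖l + m - z‖ < r → l ∈ A ∧ m ∈ B := by
    intro l hl m hm hlm
    have h1 := hd₁ l hl
    have h2 := hd₂ m hm
    have h3 : ‖l - z‖ ≤ ‖l + m - z‖ + ‖m‖ := by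
      have := norm_sub_le (l + m - z) m
      rwa [show l + m - z - m = l - z by ring] at this
    have h4 : ‖m - z‖ ≤ ‖l + m - z‖ + ‖l‖ := by
      have := norm_sub_le (l + m - z) l
      rwa [show l + m - z - l = m - z by ring] at this
    exact ⟨⟨hl, by linarith⟩, ⟨hm, by linarith⟩⟩
  have hA0 : ∀ l ∈ A, l ≠ 0 := by
    rintro l hl rfl
    have := hl.2
    rw [norm_zero] at this
    linarith
  have hB0 : ∀ l ∈ B, l ≠ 0 := by
    rintro l hl rfl
    have := hl.2
    rw [norm_zero] at this
    linarith
  refine ⟨aux_isolated_of_finite hz hrpos ?_, ?_, ?_⟩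
  · refine ((hAf.prod hBf).image (fun p : ℂ × ℂ => p.1 + p.2)).subset ?_
    rintro w ⟨hw, hwb⟩
    obtain ⟨l, hl, m, hm, rfl⟩ := h.spec_sub hw
    rw [Metric.mem_ball, dist_eq_norm] at hwb
    obtain ⟨h1, h2⟩ := hclose l hl m hm hwb
    exact ⟨(l, m), ⟨h1, h2⟩, rfl⟩
  · obtain ⟨l, hl, m, hm, rfl⟩ := h.spec_sub hz
    obtain ⟨h1, h2⟩ := hclose l hl m hm (by simpa using hrpos)
    obtain ⟨a, ha⟩ :=
      ((h.c₁.hasEigenvalue_iff_mem_spectrum (hA0 l h1)).2 hl).exists_hasEigenvector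
    obtain ⟨b, hb⟩ :=
      ((h.c₂.hasEigenvalue_iff_mem_spectrum (hB0 m h2)).2 hm).exists_hasEigenvector
    exact Module.End.hasEigenvalue_of_hasEigenvector
      ⟨Module.End.mem_eigenspace_iff.2 (h.eig ha.apply_eq_smul hb.apply_eq_smul),
        h.ne_zero ha.2 hb.2⟩
  · set P := {p : ℂ × ℂ | p ∈ A ×ˢ B ∧ p.1 + p.2 = z} with hP
    have hPf : P.Finite := (hAf.prod hBf).subset fun p hp => hp.1
    have : Finite P := hPf
    set F : Submodule ℂ H := ⨆ p : P, Submodule.map₂ tp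
      (Module.End.eigenspace (K₁ : H₁ →ₗ[ℂ] H₁) p.1.1)
      (Module.End.eigenspace (K₂ : H₂ →ₗ[ℂ] H₂) p.1.2) with hF
    have hpf : ∀ p : P, FiniteDimensional ℂ (Submodule.map₂ tp
      (Module.End.eigenspace (K₁ : H₁ →ₗ[ℂ] H₁) p.1.1)
      (Module.End.eigenspace (K₂ : H₂ →ₗ[ℂ] H₂) p.1.2) : Submodule ℂ H) := by
      intro p
      have f1 := ContinuousLinearMap.finite_dimensional_eigenspace h.c₁ p.1.1 (hA0 _ p.2.1.1)
      have f2 := ContinuousLinearMap.finite_dimensional_eigenspace h.c₂ p.1.2 (hB0 _ p.2.1.2)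
      exact Module.Finite.iff_fg.2
        (Submodule.FG.map₂ tp (Module.Finite.iff_fg.1 f1) (Module.Finite.iff_fg.1 f2))
    have hFf : FiniteDimensional ℂ F := Submodule.finiteDimensional_iSup _
    have hFE : F ≤ Module.End.eigenspace (T : H →ₗ[ℂ] H) z := by
      apply iSup_le
      intro p
      rw [Submodule.map₂_le]
      intro a ha b hb
      rw [Module.End.mem_eigenspace_iff] at ha hb ⊢
      have := h.eig ha hb
      rwa [p.2.2] at this
    have hEF : Module.End.eigenspace (T : H →ₗ[ℂ] H) z ≤ F := by
      intro v hv
      have hw0 : v - F.starProjection v = 0 := by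
        have hwE : v - F.starProjection v ∈ Module.End.eigenspace (T : H →ₗ[ℂ] H) z :=
          Submodule.sub_mem _ hv (hFE (Submodule.starProjection_apply_mem F v))
        have hwF : v - F.starProjection v ∈ Fᗮ := Submodule.sub_starProjection_mem_orthogonal v
        apply h.eig_dense
        intro l m a b ha hb
        by_cases ha0 : a = 0
        · simp [ha0]
        by_cases hb0 : b = 0
        · simp [hb0]
        by_cases hlm : l + m = z
        · obtain ⟨h1, h2⟩ := hclose l (aux_eig_mem K₁ ha ha0) m (aux_eig_mem K₂ hb hb0)
            (by simpa [hlm] using hrpos)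
          apply hwF
          refine Submodule.mem_iSup_of_mem (⟨(l, m), ⟨⟨h1, h2⟩, hlm⟩⟩ : P) ?_
          exact Submodule.apply_mem_map₂ tp (Module.End.mem_eigenspace_iff.2 ha)
            (Module.End.mem_eigenspace_iff.2 hb)
        · have := h.symT.orthogonalFamily_eigenspaces hlm
            ⟨tp a b, Module.End.mem_eigenspace_iff.2 (h.eig ha hb)⟩ ⟨_, hwE⟩
          exact this
      rw [sub_eq_zero.1 hw0]
      exact Submodule.starProjection_apply_mem F v
    exact Submodule.finiteDimensional_of_le hEF

theorem ess_eq (h : AuxTens tp K₁ K₂ T) :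
    essSpectrum T = spectrum ℂ K₁ ∪ spectrum ℂ K₂ := by
  ext z
  constructor
  · rintro ⟨hz, hnd⟩
    by_contra hc
    exact hnd (h.disc hz (fun h1 => hc (Or.inl h1)) (fun h1 => hc (Or.inr h1)))
  · rintro (hz | hz)
    · refine ⟨?_, h.not_disc hz⟩
      have := h.sub_spec hz (aux_zero_mem K₂ h.c₂ h.i₂)
      rwa [add_zero] at this
    · refine ⟨?_, h.swap.not_disc hz⟩
      have := h.sub_spec (aux_zero_mem K₁ h.c₁ h.i₁) hz
      rwa [zero_add] at this

theorem exists_ne (K : 𝓗 →L[ℂ] 𝓗) [CompleteSpace 𝓗]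
    (hK : IsCompactOperator K) (hs : (K : 𝓗 →ₗ[ℂ] 𝓗).IsSymmetric) (h0 : K ≠ 0) :
    ∃ z ∈ spectrum ℂ K, z ≠ 0 := by
  by_contra hc
  push Not at hc
  apply h0
  rw [← ContinuousLinearMap.eq_zero_of_forall_hasEigenvalue_eq_zero hK hs]
  intro m hm
  by_contra hm0
  exact hm0 (hc m ((hK.hasEigenvalue_iff_mem_spectrum hm0).1 hm))

theorem disc_inf (h : AuxTens tp K₁ K₂ T) (h₂ : K₂ ≠ 0) (hinf : (spectrum ℂ K₁).Infinite) :
    (discreteSpectrum T).Infinite := by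
  obtain ⟨b, hb, hb0⟩ := exists_ne K₂ h.c₂ h.s₂ h₂
  have hbn : 0 < ‖b‖ := norm_pos_iff.2 hb0
  set r := ‖b‖ / 2 with hr
  have hrp : 0 < r := half_pos hbn
  have hinf2 : ((fun l => l + b) '' (spectrum ℂ K₁ \ {l | l ∈ spectrum ℂ K₁ ∧ r ≤ ‖l‖})).Infinite :=
    (hinf.sdiff (aux_finite_away K₁ h.c₁ h.s₁ r hrp)).image (add_left_injective b).injOn
  refine (hinf2.sdiff ((aux_finite_away K₁ h.c₁ h.s₁ r hrp).union
    (aux_finite_away K₂ h.c₂ h.s₂ r hrp))).mono ?_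
  rintro z ⟨⟨l, ⟨hl, hlr⟩, rfl⟩, hz⟩
  have hlr' : ‖l‖ < r := by
    by_contra hc
    push Not at hc
    exact hlr ⟨hl, hc⟩
  have hbig : r ≤ ‖l + b‖ := by
    have := norm_sub_le (l + b) l
    rw [show l + b - l = b by ring] at this
    linarith
  exact h.disc (h.sub_spec hl hb) (fun h1 => hz (Or.inl ⟨h1, hbig⟩))
    (fun h1 => hz (Or.inr ⟨h1, hbig⟩))

theorem main (h : AuxTens tp K₁ K₂ T) :
    ((K₁ ≠ 0 → K₂ ≠ 0 →
      ((discreteSpectrum T).Infinite ↔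
        (discreteSpectrum K₁).Infinite ∨ (discreteSpectrum K₂).Infinite)) ∧
     ((essSpectrum T).Infinite ↔
        (discreteSpectrum K₁).Infinite ∨ (discreteSpectrum K₂).Infinite)) := by
  rw [aux_disc_infinite_iff K₁ h.c₁ h.s₁, aux_disc_infinite_iff K₂ h.c₂ h.s₂, h.ess_eq,
    Set.infinite_union]
  refine ⟨fun h1 h2 => ⟨?_, ?_⟩, Iff.rfl⟩
  · intro hd
    by_contra hc
    push Not at hc
    obtain ⟨f1, f2⟩ := hc
    refine hd ?_
    have f1 : (spectrum ℂ K₁).Finite := by simpa using f1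
    have f2 : (spectrum ℂ K₂).Finite := by simpa using f2
    refine ((f1.prod f2).image (fun p : ℂ × ℂ => p.1 + p.2)).subset ?_
    intro z hz
    obtain ⟨l, hl, m, hm, e⟩ := h.spec_sub hz.1.1
    exact ⟨(l, m), ⟨hl, hm⟩, e⟩
  · rintro (hi | hi)
    · exact h.disc_inf h2 hi
    · exact h.swap.disc_inf h1 hi

end AuxTens

section AuxLp

variable {α β : Type*} [MeasurableSpace α] [MeasurableSpace β] {μ : Measure α} {ν : Measure β}
  [IsFiniteMeasure μ] [IsFiniteMeasure ν]

theorem aux_memLp (a : Lp ℂ 2 μ) (b : Lp ℂ 2 ν) :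
    MemLp (fun p : α × β => a p.1 * b p.2) 2 (μ.prod ν) := by
  have ha := Lp.memLp a
  have hb := Lp.memLp b
  have hm : AEStronglyMeasurable (fun p : α × β => a p.1 * b p.2) (μ.prod ν) :=
    (ha.comp_fst ν).1.mul (hb.comp_snd μ).1
  rw [memLp_two_iff_integrable_sq_norm hm]
  have := ((memLp_two_iff_integrable_sq_norm ha.1).1 ha).mul_prod
    ((memLp_two_iff_integrable_sq_norm hb.1).1 hb)
  refine this.congr (Filter.Eventually.of_forall fun p => ?_)
  simp [mul_pow]

def auxTp : Lp ℂ 2 μ →ₗ[ℂ] Lp ℂ 2 ν →ₗ[ℂ] Lp ℂ 2 (μ.prod ν) :=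
  LinearMap.mk₂ ℂ (fun a b => (aux_memLp a b).toLp _)
    (by
      intro a a' b
      rw [← MemLp.toLp_add]
      apply MemLp.toLp_congr
      filter_upwards [Measure.quasiMeasurePreserving_fst.ae_eq_comp (Lp.coeFn_add a a')] with p hp
      simp only [Function.comp, Pi.add_apply] at hp ⊢
      rw [hp, add_mul])
    (by
      intro c a b
      rw [← MemLp.toLp_const_smul]
      apply MemLp.toLp_congr
      filter_upwards [Measure.quasiMeasurePreserving_fst.ae_eq_comp (Lp.coeFn_smul c a)] with p hp
      simp only [Function.comp, Pi.smul_apply] at hp ⊢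
      rw [hp, smul_mul_assoc])
    (by
      intro a b b'
      rw [← MemLp.toLp_add]
      apply MemLp.toLp_congr
      filter_upwards [Measure.quasiMeasurePreserving_snd.ae_eq_comp (Lp.coeFn_add b b')] with p hp
      simp only [Function.comp, Pi.add_apply] at hp ⊢
      rw [hp, mul_add])
    (by
      intro c a b
      rw [← MemLp.toLp_const_smul]
      apply MemLp.toLp_congr
      filter_upwards [Measure.quasiMeasurePreserving_snd.ae_eq_comp (Lp.coeFn_smul c b)] with p hp
      simp only [Function.comp, Pi.smul_apply] at hp ⊢
      rw [hp, mul_smul_comm])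

theorem auxTp_coe (a : Lp ℂ 2 μ) (b : Lp ℂ 2 ν) :
    (auxTp a b : α × β → ℂ) =ᵐ[μ.prod ν] fun p => a p.1 * b p.2 :=
  (aux_memLp a b).coeFn_toLp

theorem auxTp_inner (a : Lp ℂ 2 μ) (b : Lp ℂ 2 ν) (c : Lp ℂ 2 μ) (d : Lp ℂ 2 ν) :
    inner ℂ (auxTp a b) (auxTp c d) = inner ℂ a c * inner ℂ b d := by
  rw [L2.inner_def, L2.inner_def, L2.inner_def, ← integral_prod_mul]
  apply integral_congr_ae
  filter_upwards [auxTp_coe a b, auxTp_coe c d] with p h1 h2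
  rw [h1, h2]
  simp only [RCLike.inner_apply, map_mul]
  ring

theorem auxTp_dense (w : Lp ℂ 2 (μ.prod ν))
    (hw : ∀ (a : Lp ℂ 2 μ) (b : Lp ℂ 2 ν), inner ℂ (auxTp a b) w = 0) : w = 0 := by
  have hint : Integrable w (μ.prod ν) := (Lp.memLp w).integrable (by norm_num)
  have hrect : ∀ s t, MeasurableSet s → MeasurableSet t →
      ∫ p in s ×ˢ t, w p ∂(μ.prod ν) = 0 := by
    intro s t hs ht
    have h1 := hw (indicatorConstLp 2 hs (measure_ne_top μ s) 1)
      (indicatorConstLp 2 ht (measure_ne_top ν t) 1)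
    rw [L2.inner_def] at h1
    rw [← h1, ← integral_indicator (hs.prod ht)]
    apply integral_congr_ae
    filter_upwards [auxTp_coe (indicatorConstLp 2 hs (measure_ne_top μ s) (1 : ℂ))
      (indicatorConstLp 2 ht (measure_ne_top ν t) (1 : ℂ)),
      (Measure.quasiMeasurePreserving_fst (μ := μ) (ν := ν)).ae_eq_comp
        (indicatorConstLp_coeFn (p := 2) (hs := hs) (hμs := measure_ne_top μ s) (c := (1 : ℂ))),
      (Measure.quasiMeasurePreserving_snd (μ := μ) (ν := ν)).ae_eq_comp
        (indicatorConstLp_coeFn (p := 2) (hs := ht) (hμs := measure_ne_top ν t) (c := (1 : ℂ)))]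
      with p h1 h2 h3
    simp only [Function.comp] at h2 h3
    rw [h1, h2, h3]
    by_cases hp1 : p.1 ∈ s <;> by_cases hp2 : p.2 ∈ t <;>
      simp [Set.indicator, hp1, hp2, Set.mem_prod]
  have hall : ∀ S, MeasurableSet S → ∫ p in S, w p ∂(μ.prod ν) = 0 := by
    intro S hS
    refine MeasurableSpace.induction_on_inter
      (C := fun S _ => ∫ p in S, w p ∂(μ.prod ν) = 0) generateFrom_prod.symm isPiSystem_prod
      ?_ ?_ ?_ ?_ S hS
    · simp
    · rintro _ ⟨s, hs, t, ht, rfl⟩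
      exact hrect s t hs ht
    · intro t ht h0
      have h1 := integral_add_compl ht hint
      have h2 := hrect Set.univ Set.univ MeasurableSet.univ MeasurableSet.univ
      rw [Set.univ_prod_univ, setIntegral_univ] at h2
      rw [h0, h2, zero_add] at h1
      exact h1
    · intro f hd hm h0
      rw [integral_iUnion hm hd hint.integrableOn]
      simp [h0]
  have := hint.ae_eq_zero_of_forall_setIntegral_eq_zero (fun S hS _ => hall S hS)
  exact (Lp.eq_zero_iff_ae_eq_zero).2 this

theorem auxTp_left {k : α → α → ℂ} {K : Lp ℂ 2 μ →L[ℂ] Lp ℂ 2 μ}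
    {T : Lp ℂ 2 (μ.prod ν) →L[ℂ] Lp ℂ 2 (μ.prod ν)}
    (hK : ∀ φ : Lp ℂ 2 μ, (K φ : α → ℂ) =ᵐ[μ] fun x => ∫ s, k x s * φ s ∂μ)
    (hT : ∀ f : Lp ℂ 2 (μ.prod ν),
      (T f : α × β → ℂ) =ᵐ[μ.prod ν] fun p => ∫ s, k p.1 s * f (s, p.2) ∂μ)
    (a : Lp ℂ 2 μ) (b : Lp ℂ 2 ν) : T (auxTp a b) = auxTp (K a) b := by
  apply Lp.ext
  have hsw : ∀ᵐ y ∂ν, ∀ᵐ s ∂μ, auxTp a b (s, y) = a s * b y :=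
    Measure.ae_ae_of_ae_prod (μ := ν) (ν := μ)
      (p := fun q : β × α => auxTp a b (q.2, q.1) = a q.2 * b q.1)
      (Measure.measurePreserving_swap.quasiMeasurePreserving.ae (auxTp_coe a b))
  filter_upwards [hT (auxTp a b), auxTp_coe (K a) b,
    (Measure.quasiMeasurePreserving_fst (μ := μ) (ν := ν)).ae_eq_comp (hK a),
    (Measure.quasiMeasurePreserving_snd (μ := μ) (ν := ν)).ae hsw] with p h1 h2 h3 h4
  simp only [Function.comp] at h3
  rw [h1, h2, h3, ← integral_mul_const]
  apply integral_congr_ae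
  filter_upwards [h4] with s hs
  rw [hs, mul_assoc]

theorem auxTp_right {k : β → β → ℂ} {K : Lp ℂ 2 ν →L[ℂ] Lp ℂ 2 ν}
    {T : Lp ℂ 2 (μ.prod ν) →L[ℂ] Lp ℂ 2 (μ.prod ν)}
    (hK : ∀ φ : Lp ℂ 2 ν, (K φ : β → ℂ) =ᵐ[ν] fun x => ∫ s, k x s * φ s ∂ν)
    (hT : ∀ f : Lp ℂ 2 (μ.prod ν),
      (T f : α × β → ℂ) =ᵐ[μ.prod ν] fun p => ∫ s, k p.2 s * f (p.1, s) ∂ν)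
    (a : Lp ℂ 2 μ) (b : Lp ℂ 2 ν) : T (auxTp a b) = auxTp a (K b) := by
  apply Lp.ext
  have hsw : ∀ᵐ x ∂μ, ∀ᵐ t ∂ν, auxTp a b (x, t) = a x * b t :=
    Measure.ae_ae_of_ae_prod (auxTp_coe a b)
  filter_upwards [hT (auxTp a b), auxTp_coe a (K b),
    (Measure.quasiMeasurePreserving_snd (μ := μ) (ν := ν)).ae_eq_comp (hK b),
    (Measure.quasiMeasurePreserving_fst (μ := μ) (ν := ν)).ae hsw] with p h1 h2 h3 h4
  simp only [Function.comp] at h3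
  rw [h1, h2, h3, ← integral_const_mul]
  apply integral_congr_ae
  filter_upwards [h4] with s hs
  rw [hs]
  ring

end AuxLp

section Setting

variable {d₁ d₂ : ℕ}
  {Ω₁ : Set (EuclideanSpace ℝ (Fin d₁))} {Ω₂ : Set (EuclideanSpace ℝ (Fin d₂))}

/-- **Proposition 3.3.** Assuming `K₁ ≠ 0` and `K₂ ≠ 0`, the discrete spectrum of
`T = T₁ + T₂` is infinite iff `σ_d(K₁)` or `σ_d(K₂)` is infinite; moreover (without that
assumption) the essential spectrum of `T` is infinite iff `σ_d(K₁)` or `σ_d(K₂)` is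
infinite. -/
theorem discreteSpectrum_T_infinite_iff
    (ν₁ : Measure Ω₁) (ν₂ : Measure Ω₂) [IsFiniteMeasure ν₁] [IsFiniteMeasure ν₂]
    (k₁ : Ω₁ → Ω₁ → ℂ) (k₂ : Ω₂ → Ω₂ → ℂ)
    (K₁ : Lp ℂ 2 ν₁ →L[ℂ] Lp ℂ 2 ν₁) (K₂ : Lp ℂ 2 ν₂ →L[ℂ] Lp ℂ 2 ν₂)
    (T₁ T₂ : Lp ℂ 2 (ν₁.prod ν₂) →L[ℂ] Lp ℂ 2 (ν₁.prod ν₂))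
    (hΩ₁ : IsCompact Ω₁) (hΩ₂ : IsCompact Ω₂)
    (hk₁c : Continuous fun p : Ω₁ × Ω₁ => k₁ p.1 p.2)
    (hk₂c : Continuous fun p : Ω₂ × Ω₂ => k₂ p.1 p.2)
    (hk₁h : ∀ x s, k₁ x s = starRingEnd ℂ (k₁ s x))
    (hk₂h : ∀ y t, k₂ y t = starRingEnd ℂ (k₂ t y))
    (hK₁ : ∀ φ : Lp ℂ 2 ν₁, (K₁ φ : Ω₁ → ℂ) =ᵐ[ν₁] fun x => ∫ s, k₁ x s * φ s ∂ν₁)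
    (hK₂ : ∀ φ : Lp ℂ 2 ν₂, (K₂ φ : Ω₂ → ℂ) =ᵐ[ν₂] fun y => ∫ t, k₂ y t * φ t ∂ν₂)
    (hK₁sa : IsSelfAdjoint K₁) (hK₂sa : IsSelfAdjoint K₂)
    (hK₁cpt : IsCompactOperator K₁) (hK₂cpt : IsCompactOperator K₂)
    (hT₁ : ∀ f : Lp ℂ 2 (ν₁.prod ν₂),
      (T₁ f : Ω₁ × Ω₂ → ℂ) =ᵐ[ν₁.prod ν₂] fun p => ∫ s, k₁ p.1 s * f (s, p.2) ∂ν₁)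
    (hT₂ : ∀ f : Lp ℂ 2 (ν₁.prod ν₂),
      (T₂ f : Ω₁ × Ω₂ → ℂ) =ᵐ[ν₁.prod ν₂] fun p => ∫ t, k₂ p.2 t * f (p.1, t) ∂ν₂)
    (hinf₁ : ¬ FiniteDimensional ℂ (Lp ℂ 2 ν₁))
    (hinf₂ : ¬ FiniteDimensional ℂ (Lp ℂ 2 ν₂)) :
    ((K₁ ≠ 0 → K₂ ≠ 0 →
      ((discreteSpectrum (T₁ + T₂)).Infinite ↔
        (discreteSpectrum K₁).Infinite ∨ (discreteSpectrum K₂).Infinite)) ∧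
     ((essSpectrum (T₁ + T₂)).Infinite ↔
        (discreteSpectrum K₁).Infinite ∨ (discreteSpectrum K₂).Infinite)) := by
  have h : AuxTens (auxTp (μ := ν₁) (ν := ν₂)) K₁ K₂ (T₁ + T₂) :=
    { inn := auxTp_inner
      dense := auxTp_dense
      act := fun a b => by
        rw [ContinuousLinearMap.add_apply, auxTp_left hK₁ hT₁, auxTp_right hK₂ hT₂]
      c₁ := hK₁cpt
      c₂ := hK₂cpt
      s₁ := aux_isSymmetric hK₁sa
      s₂ := aux_isSymmetric hK₂sa
      i₁ := hinf₁
      i₂ := hinf₂ }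
  exact h.main

end Setting

end
end
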